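/- arXiv:1803.10606 — 2 statements merged into one kernel-verified Lean document; each statement's English description precedes it below -/
import Mathlib

section
/- For c ∈ ℝ, the operator L = [[c, −1], [−K, c]] on L²(ℝ)², where K = tanh(D)/D, is invertible (with bounded inverse) if and only if c² > 1. -/
open MeasureTheory SchwartzMap
open scoped FourierTransform

/-- `T` is the Fourier multiplier operator on `L²(ℝ)` with symbol `m`. -/
def IsFourierMultiplier (m : ℝ → ℂ)
    (T : Lp ℂ 2 (volume : Measure ℝ) →L[ℂ] Lp ℂ 2 (volume : Measure ℝ)) : Prop :=
  ∀ (f : 𝓢(ℝ, ℂ)) (g : Lp ℂ 2 (volume : Measure ℝ)),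
    (g : ℝ → ℂ) =ᵐ[volume] ⇑f →
      (T g : ℝ → ℂ) =ᵐ[volume] 𝓕⁻ (fun ξ => m ξ * 𝓕 (⇑f) ξ)

lemma fourierInv_self_adj (h g : ℝ → ℂ) (hh : Integrable h) (hg : Integrable g) :
    ∫ x, (𝓕⁻ g x) • h x = ∫ x, g x • (𝓕⁻ h x) := by
  have key := VectorFourier.integral_fourierIntegral_smul_eq_flip (μ := volume) (ν := volume)
    (L := -innerₗ ℝ) (f := g) (g := h) Real.continuous_fourierChar
    (by simp only [LinearMap.neg_apply, innerₗ_apply_apply]; fun_prop) hg hh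
  have e1 : ∀ u : ℝ → ℂ, VectorFourier.fourierIntegral Real.fourierChar volume (-innerₗ ℝ) u
      = 𝓕⁻ u := by
    intro u
    ext x
    simp [VectorFourier.fourierIntegral, Real.fourierInv_eq]
  have e2 : ∀ u : ℝ → ℂ, VectorFourier.fourierIntegral Real.fourierChar volume
      (-innerₗ ℝ : ℝ →ₗ[ℝ] ℝ →ₗ[ℝ] ℝ).flip u = 𝓕⁻ u := by
    intro u
    ext x
    simp [VectorFourier.fourierIntegral, Real.fourierInv_eq, mul_comm]
  rw [e2] at key
  rw [e1] at key
  exact key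

lemma fourierInv_L2_eq (h : ℝ → ℂ) (h1 : Integrable h) (h2 : MemLp h 2 volume)
    (G : Lp ℂ 2 (volume : Measure ℝ)) (hG : (G : ℝ → ℂ) =ᵐ[volume] 𝓕⁻ h) :
    G = 𝓕⁻ (h2.toLp h) := by
  have hinj := LinearMap.ker_eq_bot.1
    (Lp.ker_toTemperedDistributionCLM_eq_bot (F := ℂ) (μ := (volume : Measure ℝ)) (p := 2))
  apply hinj
  simp only [ContinuousLinearMap.coe_coe, Lp.toTemperedDistributionCLM_apply]
  rw [← Lp.fourierInv_toTemperedDistribution_eq]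
  ext g
  rw [TemperedDistribution.fourierInv_apply, Lp.toTemperedDistribution_apply,
    Lp.toTemperedDistribution_apply]
  have a1 : ∫ x, g x • G x = ∫ x, g x • (𝓕⁻ h x) := by
    apply integral_congr_ae
    filter_upwards [hG] with x hx
    rw [hx]
  have a2 : ∫ x, (𝓕⁻ g) x • (h2.toLp h) x = ∫ x, (𝓕⁻ (g : ℝ → ℂ) x) • h x := by
    apply integral_congr_ae
    filter_upwards [h2.coeFn_toLp] with x hx
    rw [hx, SchwartzMap.fourierInv_coe]
  rw [a1, a2, fourierInv_self_adj h g h1 g.integrable]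

/-- The real symbol. -/
noncomputable def kSym (ξ : ℝ) : ℝ := if ξ = 0 then 1 else Real.tanh ξ / ξ

lemma hasDerivAt_tanh' (x : ℝ) : HasDerivAt Real.tanh (1 / Real.cosh x ^ 2) x := by
  have h := (Real.hasDerivAt_sinh x).div (Real.hasDerivAt_cosh x) (Real.cosh_pos x).ne'
  have e : Real.sinh / Real.cosh = Real.tanh := by
    ext y; simp [Real.tanh_eq_sinh_div_cosh]
  rw [e] at h
  have e2 : Real.cosh x * Real.cosh x - Real.sinh x * Real.sinh x = 1 := by
    have := Real.cosh_sq x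
    linarith [pow_two (Real.cosh x), pow_two (Real.sinh x)]
  rwa [e2] at h

lemma abs_tanh_le (x : ℝ) : |Real.tanh x| ≤ |x| := by
  have h := Convex.norm_image_sub_le_of_norm_hasDerivWithin_le (f := Real.tanh)
    (f' := fun x => 1 / Real.cosh x ^ 2) (C := 1) (s := Set.univ) (x := 0) (y := x)
    (fun y _ => (hasDerivAt_tanh' y).hasDerivWithinAt)
    (fun y _ => by
      have := Real.one_le_cosh y
      rw [Real.norm_of_nonneg (by positivity)]
      rw [div_le_one (by positivity)]
      nlinarith) convex_univ trivial trivial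
  simpa using h

lemma kSym_abs_le (x : ℝ) : |kSym x| ≤ 1 := by
  unfold kSym
  split_ifs with h
  · simp
  · rw [abs_div, div_le_one (abs_pos.2 h)]
    exact abs_tanh_le x

lemma kSym_eq : kSym = dslope Real.tanh 0 := by
  ext x
  by_cases h : x = 0
  · subst h
    simp [kSym, (hasDerivAt_tanh' 0).deriv]
  · simp [kSym, h, dslope_of_ne, slope_def_field]

lemma kSym_cont : Continuous kSym := by
  rw [kSym_eq, continuous_iff_continuousAt]
  intro x
  by_cases h : x = 0
  · subst h
    exact continuousAt_dslope_same.2 (hasDerivAt_tanh' 0).differentiableAt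
  · exact (continuousAt_dslope_of_ne h).2 (hasDerivAt_tanh' x).continuousAt

lemma kSym_hit_pos (a : ℝ) (h0 : 0 < a) (h1 : a ≤ 1) : ∃ ξ, kSym ξ = a := by
  have hk : kSym (1 / a) ≤ a := by
    have : (1 / a) ≠ 0 := by positivity
    simp only [kSym, this, if_false]
    have := Real.tanh_lt_one (1 / a)
    rw [div_div_eq_mul_div, div_one]
    nlinarith
  have hk0 : a ≤ kSym 0 := by simpa [kSym] using h1
  exact mem_range_of_exists_le_of_exists_ge kSym_cont ⟨_, hk⟩ ⟨_, hk0⟩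

lemma kSym_hit (a : ℝ) (h0 : 0 ≤ a) (h1 : a ≤ 1) (ε : ℝ) (hε : 0 < ε) :
    ∃ ξ, |a - kSym ξ| < ε := by
  rcases h0.eq_or_lt with h | h
  · obtain ⟨ξ, hξ⟩ := kSym_hit_pos (min (ε / 2) 1) (by positivity) (min_le_right _ _)
    refine ⟨ξ, ?_⟩
    have h3 : 0 < min (ε / 2) 1 := by positivity
    rw [hξ, ← h, zero_sub, abs_neg, abs_of_pos h3]
    linarith [min_le_left (ε / 2) 1]
  · obtain ⟨ξ, hξ⟩ := kSym_hit_pos a h h1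
    exact ⟨ξ, by simpa [hξ] using hε⟩

/-- Key estimate on Schwartz functions, via Plancherel. -/
lemma key_est (K : Lp ℂ 2 (volume : Measure ℝ) →L[ℂ] Lp ℂ 2 (volume : Measure ℝ))
    (hK : IsFourierMultiplier (fun ξ => ((kSym ξ : ℝ) : ℂ)) K) (f : 𝓢(ℝ, ℂ)) (a C : ℝ)
    (hb : ∀ ξ, |a - kSym ξ| * ‖𝓕 f ξ‖ ≤ C * ‖𝓕 f ξ‖) :
    ‖(a : ℂ) • f.toLp 2 volume - K (f.toLp 2 volume)‖ ≤ C * ‖f.toLp 2 (volume : Measure ℝ)‖ := by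
  have hm : AEStronglyMeasurable (fun ξ => ((kSym ξ : ℝ) : ℂ) * 𝓕 f ξ) volume :=
    ((Complex.continuous_ofReal.comp kSym_cont).mul (𝓕 f).continuous).aestronglyMeasurable
  have hle : ∀ᵐ ξ, ‖((kSym ξ : ℝ) : ℂ) * 𝓕 f ξ‖ ≤ ‖𝓕 f ξ‖ := by
    refine Filter.Eventually.of_forall fun ξ => ?_
    rw [norm_mul, Complex.norm_real, Real.norm_eq_abs]
    exact mul_le_of_le_one_left (norm_nonneg _) (kSym_abs_le ξ)
  have h1 : Integrable (fun ξ => ((kSym ξ : ℝ) : ℂ) * 𝓕 f ξ) := (𝓕 f).integrable.mono hm hle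
  have h2 : MemLp (fun ξ => ((kSym ξ : ℝ) : ℂ) * 𝓕 f ξ) 2 volume :=
    ((𝓕 f).memLp 2 volume).mono hm hle
  have hG := fourierInv_L2_eq _ h1 h2 (K (f.toLp 2 volume))
    (hK f _ (f.coeFn_toLp 2 volume))
  have hF : 𝓕 (K (f.toLp 2 volume)) = h2.toLp _ := by
    rw [hG, FourierTransform.fourier_fourierInv_eq]
  have e1 : ‖(a : ℂ) • f.toLp 2 volume - K (f.toLp 2 volume)‖
      = ‖(a : ℂ) • (𝓕 f).toLp 2 volume - h2.toLp _‖ := by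
    have e0 : 𝓕 ((a : ℂ) • f.toLp 2 volume - K (f.toLp 2 volume))
        = (a : ℂ) • 𝓕 (f.toLp 2 volume) - 𝓕 (K (f.toLp 2 volume)) := by
      have := map_sub (Lp.fourierTransformₗᵢ ℝ ℂ) ((a : ℂ) • f.toLp 2 volume)
        (K (f.toLp 2 volume))
      rw [map_smul] at this
      exact this
    rw [← Lp.norm_fourier_eq, e0, hF, SchwartzMap.toLp_fourier_eq]
  have e2 : ‖f.toLp 2 (volume : Measure ℝ)‖ = ‖(𝓕 f).toLp 2 (volume : Measure ℝ)‖ := by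
    rw [← Lp.norm_fourier_eq, SchwartzMap.toLp_fourier_eq]
  rw [e1, e2]
  apply Lp.norm_le_mul_norm_of_ae_le_mul
  filter_upwards [Lp.coeFn_sub ((a : ℂ) • (𝓕 f).toLp 2 volume) (h2.toLp _),
    Lp.coeFn_smul (a : ℂ) ((𝓕 f).toLp 2 (volume : Measure ℝ)), h2.coeFn_toLp,
    (𝓕 f).coeFn_toLp 2 volume] with ξ x1 x2 x3 x4
  rw [x1, Pi.sub_apply, x2, Pi.smul_apply, x3, x4, smul_eq_mul, ← sub_mul, norm_mul,
    ← Complex.ofReal_sub, Complex.norm_real]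
  exact hb ξ

lemma K_norm_le (K : Lp ℂ 2 (volume : Measure ℝ) →L[ℂ] Lp ℂ 2 (volume : Measure ℝ))
    (hK : IsFourierMultiplier (fun ξ => ((kSym ξ : ℝ) : ℂ)) K) : ‖K‖ ≤ 1 := by
  refine K.opNorm_le_bound zero_le_one fun g => ?_
  refine DenseRange.induction_on (p := fun g => ‖K g‖ ≤ 1 * ‖g‖)
    (SchwartzMap.denseRange_toLpCLM (F := ℂ) (p := 2) (μ := (volume : Measure ℝ))
      ENNReal.ofNat_ne_top) g ?_ ?_
  · exact isClosed_le (by fun_prop) (by fun_prop)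
  · intro f
    have := key_est K hK f 0 1 (fun ξ => by
      rw [zero_sub, abs_neg]
      exact mul_le_mul_of_nonneg_right (kSym_abs_le ξ) (norm_nonneg _))
    simpa using this

lemma exists_approx (K : Lp ℂ 2 (volume : Measure ℝ) →L[ℂ] Lp ℂ 2 (volume : Measure ℝ))
    (hK : IsFourierMultiplier (fun ξ => ((kSym ξ : ℝ) : ℂ)) K)
    (a : ℝ) (h0 : 0 ≤ a) (h1 : a ≤ 1) (ε : ℝ) (hε : 0 < ε) :
    ∃ g : Lp ℂ 2 (volume : Measure ℝ), g ≠ 0 ∧ ‖(a : ℂ) • g - K g‖ ≤ ε * ‖g‖ := by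
  obtain ⟨ξ₀, hξ₀⟩ := kSym_hit a h0 h1 ε hε
  have hopen : IsOpen {ξ | |a - kSym ξ| < ε} :=
    isOpen_lt (continuous_const.sub kSym_cont).abs continuous_const
  obtain ⟨r, hr, hball⟩ := Metric.isOpen_iff.1 hopen ξ₀ hξ₀
  let b : ContDiffBump ξ₀ := ⟨r / 2, r, by positivity, by linarith⟩
  have hc : HasCompactSupport (Complex.ofRealCLM ∘ b) := b.hasCompactSupport.comp_left rfl
  have hs : ContDiff ℝ ((⊤ : ℕ∞) : WithTop ℕ∞) (Complex.ofRealCLM ∘ b) :=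
    Complex.ofRealCLM.contDiff.comp b.contDiff
  let φ : 𝓢(ℝ, ℂ) := hc.toSchwartzMap hs
  have hφ : ∀ ξ, φ ξ = (b ξ : ℂ) := fun ξ => rfl
  have hφφ : 𝓕 (𝓕⁻ φ) = φ := FourierTransform.fourier_fourierInv_eq φ
  refine ⟨(𝓕⁻ φ).toLp 2 volume, ?_, ?_⟩
  · intro hz
    have hz' : (𝓕⁻ φ).toLp 2 (volume : Measure ℝ) = (0 : 𝓢(ℝ, ℂ)).toLp 2 volume := by
      rw [hz]; exact (map_zero (SchwartzMap.toLpCLM ℂ ℂ 2 (volume : Measure ℝ))).symm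
    have h3 : 𝓕⁻ φ = 0 := SchwartzMap.injective_toLp 2 volume hz'
    have h4 : φ = 0 := by
      rw [← hφφ, h3, FourierTransform.fourier_zero]
    have h5 : φ ξ₀ = 0 := by rw [h4]; rfl
    rw [hφ, b.one_of_mem_closedBall] at h5
    · simp at h5
    · exact Metric.mem_closedBall_self (by positivity)
  · apply key_est K hK
    intro ξ
    rw [hφφ]
    by_cases hξ : ξ ∈ Metric.ball ξ₀ r
    · exact mul_le_mul_of_nonneg_right (le_of_lt (hball hξ)) (norm_nonneg _)
    · have : b ξ = 0 := b.zero_of_le_dist (by simpa using hξ)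
      simp [hφ, this]

/-- The operator `L = [[c, −1], [−K, c]]` on `L²(ℝ)²`, with `K = tanh D / D`, is invertible
with bounded inverse if and only if `c² > 1`. -/
theorem L_invertible_iff (c : ℝ)
    (K : Lp ℂ 2 (volume : Measure ℝ) →L[ℂ] Lp ℂ 2 (volume : Measure ℝ))
    (hK : IsFourierMultiplier
      (fun ξ => ((if ξ = 0 then 1 else Real.tanh ξ / ξ : ℝ) : ℂ)) K)
    (L : (Lp ℂ 2 (volume : Measure ℝ) × Lp ℂ 2 (volume : Measure ℝ)) →L[ℂ]
         (Lp ℂ 2 (volume : Measure ℝ) × Lp ℂ 2 (volume : Measure ℝ)))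
    (hL : ∀ p, L p = ((c : ℂ) • p.1 - p.2, -(K p.1) + (c : ℂ) • p.2)) :
    (∃ M : (Lp ℂ 2 (volume : Measure ℝ) × Lp ℂ 2 (volume : Measure ℝ)) →L[ℂ]
         (Lp ℂ 2 (volume : Measure ℝ) × Lp ℂ 2 (volume : Measure ℝ)),
       M.comp L = ContinuousLinearMap.id ℂ _ ∧ L.comp M = ContinuousLinearMap.id ℂ _)
      ↔ c ^ 2 > 1 := by
  have hK' : IsFourierMultiplier (fun ξ => ((kSym ξ : ℝ) : ℂ)) K := hK
  constructor
  · rintro ⟨M, hM, -⟩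
    by_contra hc
    have hc1 : c ^ 2 ≤ 1 := not_lt.1 hc
    obtain ⟨g, hg0, hg⟩ := exists_approx K hK' (c ^ 2) (sq_nonneg c) hc1
      (1 / (‖M‖ + 1) / 2) (by positivity)
    have hLg : L (g, (c : ℂ) • g) = (0, ((c ^ 2 : ℝ) : ℂ) • g - K g) := by
      rw [hL]
      ext1
      · simp
      · simp only [smul_smul]
        push_cast
        rw [← pow_two]
        abel
    have hMg : M (L (g, (c : ℂ) • g)) = (g, (c : ℂ) • g) := by
      have := congrArg (fun T => T (g, (c : ℂ) • g)) hM
      simpa using this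
    have hn1 : ‖g‖ ≤ ‖M (L (g, (c : ℂ) • g))‖ := by
      rw [hMg]; exact norm_fst_le (g, (c : ℂ) • g)
    have hn2 := M.le_opNorm (L (g, (c : ℂ) • g))
    have hn3 : ‖L (g, (c : ℂ) • g)‖ = ‖((c ^ 2 : ℝ) : ℂ) • g - K g‖ := by
      rw [hLg, Prod.norm_def]; simp
    have hgp : 0 < ‖g‖ := norm_pos_iff.2 hg0
    rw [hn3] at hn2
    have hM0 := norm_nonneg M
    have h6 : ‖M‖ * ‖((c ^ 2 : ℝ) : ℂ) • g - K g‖ ≤ ‖M‖ * (1 / (‖M‖ + 1) / 2 * ‖g‖) :=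
      mul_le_mul_of_nonneg_left hg hM0
    have h7 : ‖M‖ * (1 / (‖M‖ + 1) / 2 * ‖g‖) ≤ 1 / 2 * ‖g‖ := by
      have : ‖M‖ * (1 / (‖M‖ + 1)) ≤ 1 := by
        rw [mul_one_div, div_le_one (by positivity)]; linarith
      nlinarith
    linarith
  · intro hc
    have hKn := K_norm_le K hK'
    have hc0 : (0 : ℝ) < c ^ 2 := by linarith
    have hcC : ((c : ℂ) ^ 2) ≠ 0 := by exact_mod_cast hc0.ne'
    have hlt : ‖((c : ℂ) ^ 2)⁻¹ • K‖ < 1 := by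
      rw [norm_smul, norm_inv, norm_pow, Complex.norm_real, Real.norm_eq_abs, sq_abs]
      have : (c ^ 2)⁻¹ < 1 := inv_lt_one_of_one_lt₀ hc
      have h0 : 0 < (c ^ 2)⁻¹ := by positivity
      nlinarith [norm_nonneg K]
    obtain ⟨u, hu⟩ := isUnit_one_sub_of_norm_lt_one hlt
    let S : Lp ℂ 2 (volume : Measure ℝ) →L[ℂ] Lp ℂ 2 (volume : Measure ℝ) := ↑u⁻¹
    have hR1 : ∀ x, S (x - ((c : ℂ) ^ 2)⁻¹ • K x) = x := by
      intro x
      have := congrArg (fun T => T x) u.inv_mul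
      rw [hu] at this
      simpa using this
    have hR2 : ∀ x, S x - ((c : ℂ) ^ 2)⁻¹ • K (S x) = x := by
      intro x
      have := congrArg (fun T => T x) u.mul_inv
      rw [hu] at this
      simpa using this
    let R := ((c : ℂ) ^ 2)⁻¹ • S
    have hR1' : ∀ x, R ((c : ℂ) ^ 2 • x - K x) = x := by
      intro x
      have e : (c : ℂ) ^ 2 • x - K x = (c : ℂ) ^ 2 • (x - ((c : ℂ) ^ 2)⁻¹ • K x) := by
        rw [smul_sub, smul_inv_smul₀ hcC]
      rw [e]
      simp only [R, smul_apply, map_smul, hR1, smul_inv_smul₀ hcC]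
    have hR2' : ∀ x, (c : ℂ) ^ 2 • R x - K (R x) = x := by
      intro x
      simp only [R, smul_apply, map_smul, smul_inv_smul₀ hcC, hR2]
    let P := ContinuousLinearMap.fst ℂ (Lp ℂ 2 (volume : Measure ℝ)) (Lp ℂ 2 (volume : Measure ℝ))
    let Q := ContinuousLinearMap.snd ℂ (Lp ℂ 2 (volume : Measure ℝ)) (Lp ℂ 2 (volume : Measure ℝ))
    let U := R.comp (Q + (c : ℂ) • P)
    have hU : ∀ p, U p = R (p.2 + (c : ℂ) • p.1) := fun p => rfl
    have hM : ∀ p, (U.prod ((c : ℂ) • U - P)) p = (U p, (c : ℂ) • U p - p.1) := fun p => rfl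
    refine ⟨U.prod ((c : ℂ) • U - P), ?_, ?_⟩
    · refine ContinuousLinearMap.ext fun p => ?_
      have hUL : U (L p) = p.1 := by
        rw [hU, hL]
        have e : (-(K p.1) + (c : ℂ) • p.2) + (c : ℂ) • ((c : ℂ) • p.1 - p.2)
            = (c : ℂ) ^ 2 • p.1 - K p.1 := by
          rw [smul_sub, smul_smul, ← pow_two]; abel
        rw [e, hR1']
      rw [ContinuousLinearMap.comp_apply, hM, hUL, hL]
      simp
    · refine ContinuousLinearMap.ext fun p => ?_
      rw [ContinuousLinearMap.comp_apply, hM, hL]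
      have h2 := hR2' (p.2 + (c : ℂ) • p.1)
      rw [← hU] at h2
      ext1
      · simp
      · simp only [ContinuousLinearMap.id_apply]
        rw [smul_sub, smul_smul, ← pow_two]
        have e : -(K (U p)) + ((c : ℂ) ^ 2 • U p - (c : ℂ) • p.1)
          = ((c : ℂ) ^ 2 • U p - K (U p)) - (c : ℂ) • p.1 := by abel
        rw [e, h2]; abel
end

section
/- For real-valued θ ∈ H^{1/2}(ℝ), ζ ∈ H^{1/2}(ℝ), and w ∈ H¹(ℝ), the estimate |∫ θ ∂ₓ(ζw) dx| ≤ C‖ζ‖_{H^{1/2}}‖θ‖_{H^{1/2}}‖w‖_{H¹} holds with a universal constant C. -/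
open MeasureTheory SchwartzMap
open scoped FourierTransform

/-- The `H^{1/2}(ℝ)` norm of a real-valued Schwartz function, on the Fourier side. -/
noncomputable def HhalfNormR (f : 𝓢(ℝ, ℝ)) : ℝ :=
  Real.sqrt (∫ ξ : ℝ, (1 + ξ ^ 2) ^ ((1 : ℝ) / 2) * ‖𝓕 (fun x => (f x : ℂ)) ξ‖ ^ 2)

/-- The `H^1(ℝ)` norm of a real-valued Schwartz function, on the Fourier side. -/
noncomputable def HoneNormR (f : 𝓢(ℝ, ℝ)) : ℝ :=
  Real.sqrt (∫ ξ : ℝ, (1 + ξ ^ 2) * ‖𝓕 (fun x => (f x : ℂ)) ξ‖ ^ 2)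



open scoped ENNReal InnerProductSpace

/-- Cauchy-Schwarz for lower integrals. -/
lemma aux_cs (f g : ℝ → ℝ≥0∞) (hf : Measurable f) (hg : Measurable g) :
    ∫⁻ x, f x * g x ≤ (∫⁻ x, f x ^ 2) ^ ((1 : ℝ) / 2) * (∫⁻ x, g x ^ 2) ^ ((1 : ℝ) / 2) := by
  have h := ENNReal.lintegral_mul_le_Lp_mul_Lq volume Real.HolderConjugate.two_two
    hf.aemeasurable hg.aemeasurable
  simpa using h

/-- Young-type trilinear estimate. -/
lemma aux_young (f g h : ℝ → ℝ≥0∞) (hf : Measurable f) (hg : Measurable g) (hh : Measurable h) :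
    ∫⁻ x, ∫⁻ t, f x * g (x - t) * h t ≤
      (∫⁻ x, f x ^ 2) ^ ((1 : ℝ) / 2) * (∫⁻ x, g x ^ 2) ^ ((1 : ℝ) / 2) * ∫⁻ t, h t := by
  rw [lintegral_lintegral_swap (by fun_prop)]
  rw [← lintegral_const_mul _ hh]
  refine lintegral_mono fun t => ?_
  dsimp only
  rw [lintegral_mul_const _ (by fun_prop)]
  gcongr
  refine (aux_cs f (fun x => g (x - t)) hf (by fun_prop)).trans_eq ?_
  rw [lintegral_sub_right_eq_self (fun x => g x ^ 2) t]

lemma aux_young' (f g h : ℝ → ℝ≥0∞) (hf : Measurable f) (hg : Measurable g) (hh : Measurable h) :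
    ∫⁻ x, ∫⁻ t, f x * g (x - t) * h t ≤
      (∫⁻ x, f x ^ 2) ^ ((1 : ℝ) / 2) * (∫⁻ x, h x ^ 2) ^ ((1 : ℝ) / 2) * ∫⁻ t, g t := by
  refine le_trans (le_of_eq ?_) (aux_young f h g hf hh hg)
  refine lintegral_congr fun x => ?_
  rw [← lintegral_sub_left_eq_self _ x]
  refine lintegral_congr fun t => ?_
  rw [sub_sub_cancel]; ring

/-- `(1 + x^2)^(1/4)`. -/
noncomputable def auxH (x : ℝ) : ℝ := Real.sqrt (Real.sqrt (1 + x ^ 2))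

lemma auxH_one_le (x : ℝ) : 1 ≤ auxH x := by
  unfold auxH
  rw [Real.one_le_sqrt, Real.one_le_sqrt]; nlinarith [sq_nonneg x]

lemma auxH_sq (x : ℝ) : auxH x ^ 2 = Real.sqrt (1 + x ^ 2) := by
  unfold auxH
  rw [Real.sq_sqrt (by positivity)]

lemma auxH_four (x : ℝ) : (auxH x ^ 2) ^ 2 = 1 + x ^ 2 := by
  rw [auxH_sq, Real.sq_sqrt (by positivity)]

lemma auxH_cont : Continuous auxH := by unfold auxH; fun_prop

lemma auxH_add (s t : ℝ) : auxH (s + t) ≤ auxH s + auxH t := by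
  have h1 := auxH_one_le s
  have h2 := auxH_one_le t
  have h3 := auxH_one_le (s + t)
  have key : auxH (s + t) ^ 2 ≤ auxH s ^ 2 + auxH t ^ 2 := by
    have e1 := auxH_four s
    have e2 := auxH_four t
    have e3 := auxH_four (s + t)
    have hs : |s| ≤ auxH s ^ 2 := by
      apply abs_le_of_sq_le_sq _ (by positivity); linarith
    have ht : |t| ≤ auxH t ^ 2 := by
      apply abs_le_of_sq_le_sq _ (by positivity); linarith
    have hst : s * t ≤ auxH s ^ 2 * auxH t ^ 2 := by
      refine (le_abs_self _).trans ?_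
      rw [abs_mul]; gcongr
    apply le_of_sq_le_sq _ (by positivity)
    nlinarith
  nlinarith

lemma aux_weight (s t : ℝ) :
    |s + t| ≤ 2 * (auxH (s + t) * auxH s + auxH (s + t) * (auxH s)⁻¹ * auxH t ^ 2) := by
  have h1 := auxH_one_le s
  have h2 := auxH_one_le t
  have h3 := auxH_one_le (s + t)
  have h4 := auxH_add s t
  have h5 : |s + t| ≤ auxH (s + t) ^ 2 := by
    apply abs_le_of_sq_le_sq _ (by positivity)
    rw [auxH_four]; linarith
  have h6 : auxH t ≤ auxH s + (auxH s)⁻¹ * auxH t ^ 2 := by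
    have : 0 < auxH s := by linarith
    have : auxH s + (auxH s)⁻¹ * auxH t ^ 2 - auxH t
      = (auxH s)⁻¹ * (auxH s ^ 2 + auxH t ^ 2 - auxH s * auxH t) := by
      field_simp
    have h : 0 ≤ (auxH s)⁻¹ * (auxH s ^ 2 + auxH t ^ 2 - auxH s * auxH t) := by
      apply mul_nonneg (by positivity); nlinarith [sq_nonneg (auxH s - auxH t)]
    linarith
  have h7 : 0 ≤ (auxH s)⁻¹ * auxH t ^ 2 := by positivity
  calc |s + t| ≤ auxH (s + t) * auxH (s + t) := by linarith [sq (auxH (s + t))]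
    _ ≤ auxH (s + t) * (2 * (auxH s + (auxH s)⁻¹ * auxH t ^ 2)) := by
      gcongr; linarith
    _ = _ := by ring

/-- Complexification. -/
noncomputable def auxC (f : 𝓢(ℝ, ℝ)) : 𝓢(ℝ, ℂ) := postcompCLM Complex.ofRealCLM f

lemma auxC_apply (f : 𝓢(ℝ, ℝ)) (x : ℝ) : auxC f x = (f x : ℂ) := rfl

lemma auxC_fourier (f : 𝓢(ℝ, ℝ)) : 𝓕 (fun x => (f x : ℂ)) = ((𝓕 (auxC f) : 𝓢(ℝ, ℂ)) : ℝ → ℂ) := rfl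

lemma aux_int (f : 𝓢(ℝ, ℂ)) : Integrable (fun x => (1 + x ^ 2) * ‖f x‖ ^ 2) := by
  obtain ⟨C, hC⟩ : ∃ C, ∀ x, ‖f x‖ ≤ C := ⟨_, norm_le_seminorm ℝ f⟩
  have h0 := f.integrable_pow_mul volume 0
  have h2 := f.integrable_pow_mul volume 2
  refine ((h0.add h2).const_mul C).mono' (by fun_prop) (.of_forall fun x => ?_)
  have hx := hC x
  rw [Real.norm_of_nonneg (by positivity)]
  simp only [Pi.add_apply, pow_zero, Real.norm_eq_abs, sq_abs]
  calc (1 + x ^ 2) * ‖f x‖ ^ 2 = ‖f x‖ * ((1 + x ^ 2) * ‖f x‖) := by ring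
    _ ≤ C * ((1 + x ^ 2) * ‖f x‖) := by gcongr
    _ = _ := by ring

lemma aux_int' (f : 𝓢(ℝ, ℂ)) : Integrable (fun x => (auxH x * ‖f x‖) ^ 2) := by
  have := auxH_cont
  refine (aux_int f).mono' (by fun_prop) (.of_forall fun x => ?_)
  rw [Real.norm_of_nonneg (by positivity), mul_pow]
  gcongr
  rw [← auxH_four]
  have := auxH_one_le x
  have h2 : 1 ≤ auxH x ^ 2 := one_le_pow₀ this
  nlinarith

lemma aux_half (f : 𝓢(ℝ, ℝ)) :
    (∫⁻ x, ENNReal.ofReal (auxH x * ‖𝓕 (auxC f) x‖) ^ 2) ^ ((1 : ℝ) / 2)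
      = ENNReal.ofReal (HhalfNormR f) := by
  have h : ∀ x, ENNReal.ofReal (auxH x * ‖𝓕 (auxC f) x‖) ^ 2
      = ENNReal.ofReal ((auxH x * ‖𝓕 (auxC f) x‖) ^ 2) := fun x => by
    have := auxH_one_le x
    rw [ENNReal.ofReal_pow (by positivity)]
  simp_rw [h]
  rw [← ofReal_integral_eq_lintegral_ofReal (aux_int' _) (.of_forall fun x => by positivity),
    ENNReal.ofReal_rpow_of_nonneg (integral_nonneg fun x => by positivity) (by norm_num),
    ← Real.sqrt_eq_rpow]
  unfold HhalfNormR
  simp_rw [mul_pow, auxH_sq, auxC_fourier, Real.sqrt_eq_rpow]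

lemma aux_one (f : 𝓢(ℝ, ℝ)) :
    (∫⁻ x, ENNReal.ofReal (auxH x ^ 2 * ‖𝓕 (auxC f) x‖) ^ 2) ^ ((1 : ℝ) / 2)
      = ENNReal.ofReal (HoneNormR f) := by
  have h : ∀ x, ENNReal.ofReal (auxH x ^ 2 * ‖𝓕 (auxC f) x‖) ^ 2
      = ENNReal.ofReal ((1 + x ^ 2) * ‖𝓕 (auxC f) x‖ ^ 2) := fun x => by
    have := auxH_one_le x
    rw [← ENNReal.ofReal_pow (by positivity), mul_pow, auxH_four]
  simp_rw [h]
  rw [← ofReal_integral_eq_lintegral_ofReal (aux_int _) (.of_forall fun x => by positivity),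
    ENNReal.ofReal_rpow_of_nonneg (integral_nonneg fun x => by positivity) (by norm_num),
    ← Real.sqrt_eq_rpow]
  rfl

lemma aux_pi : (∫⁻ x, ENNReal.ofReal ((auxH x ^ 2)⁻¹) ^ 2) ^ ((1 : ℝ) / 2)
      = ENNReal.ofReal (Real.sqrt Real.pi) := by
  have h : ∀ x, ENNReal.ofReal ((auxH x ^ 2)⁻¹) ^ 2
      = ENNReal.ofReal ((1 + x ^ 2)⁻¹) := fun x => by
    have := auxH_one_le x
    rw [← ENNReal.ofReal_pow (by positivity), inv_pow, auxH_four]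
  simp_rw [h]
  rw [← ofReal_integral_eq_lintegral_ofReal integrable_inv_one_add_sq
      (.of_forall fun x => by positivity),
    ENNReal.ofReal_rpow_of_nonneg (integral_nonneg fun x => by positivity) (by norm_num),
    ← Real.sqrt_eq_rpow, integral_univ_inv_one_add_sq]

lemma aux_L1 (g : ℝ → ℝ) (hg : Measurable g) :
    ∫⁻ x, ENNReal.ofReal ((auxH x ^ 2)⁻¹ * g x) ≤
      ENNReal.ofReal (Real.sqrt Real.pi) *
        (∫⁻ x, ENNReal.ofReal (g x) ^ 2) ^ ((1 : ℝ) / 2) := by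
  have hm := auxH_cont.measurable
  rw [← aux_pi]
  refine le_trans (le_of_eq ?_) (aux_cs _ _ (by fun_prop) (by fun_prop))
  refine lintegral_congr fun x => ?_
  rw [ENNReal.ofReal_mul (by positivity)]

/-- Product of two Schwartz functions. -/
noncomputable def auxP (u v : 𝓢(ℝ, ℂ)) : 𝓢(ℝ, ℂ) := pairing (ContinuousLinearMap.mul ℂ ℂ) u v

lemma auxP_apply (u v : 𝓢(ℝ, ℂ)) (x : ℝ) : auxP u v x = u x * v x := by
  simp [auxP]

lemma auxP_fourier (u v : 𝓢(ℝ, ℂ)) (ξ : ℝ) :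
    ‖𝓕 (auxP u v) ξ‖ₑ ≤ ∫⁻ t, ‖𝓕 u (ξ - t)‖ₑ * ‖𝓕 v t‖ₑ := by
  have h1 : auxP u v = 𝓕 (SchwartzMap.convolution (ContinuousLinearMap.mul ℂ ℂ) (𝓕⁻ u) (𝓕⁻ v)) := by
    rw [fourier_convolution]; simp [auxP]
  have hinv : ∀ (f : 𝓢(ℝ, ℂ)) (x : ℝ), 𝓕⁻ f x = 𝓕 f (-x) := fun f x => by
    rw [fourierInv_coe, Real.fourierInv_eq_fourier_neg]; rfl
  have h2 : 𝓕 (auxP u v) ξ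
      = SchwartzMap.convolution (ContinuousLinearMap.mul ℂ ℂ) (𝓕⁻ u) (𝓕⁻ v) (-ξ) := by
    have := hinv (auxP u v) (-ξ)
    rw [neg_neg] at this
    rw [← this, h1]; simp
  rw [h2, SchwartzMap.convolution_apply, convolution_def]
  refine (enorm_integral_le_lintegral_enorm _).trans (le_of_eq ?_)
  rw [← lintegral_sub_left_eq_self (μ := volume) _ (-ξ)]
  rw [← lintegral_neg_eq_self (μ := volume)]
  refine lintegral_congr fun x => ?_
  rw [ContinuousLinearMap.mul_apply', enorm_mul, hinv, hinv]
  congr 3 <;> ring_nf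

lemma aux_main (θ ζ w : 𝓢(ℝ, ℝ)) :
    ∫⁻ ξ, ∫⁻ t, ‖𝓕 (auxC θ) ξ‖ₑ * ENNReal.ofReal |ξ| *
      (‖𝓕 (auxC ζ) (ξ - t)‖ₑ * ‖𝓕 (auxC w) t‖ₑ) ≤
    ENNReal.ofReal (4 * Real.sqrt Real.pi * HhalfNormR ζ * HhalfNormR θ * HoneNormR w) := by
  have hc := auxH_cont
  have hm := auxH_cont.measurable
  have hT : Measurable (fun x => ‖𝓕 (auxC θ) x‖) := (𝓕 (auxC θ)).continuous.norm.measurable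
  have hZ : Measurable (fun x => ‖𝓕 (auxC ζ) x‖) := (𝓕 (auxC ζ)).continuous.norm.measurable
  have hW : Measurable (fun x => ‖𝓕 (auxC w) x‖) := (𝓕 (auxC w)).continuous.norm.measurable
  set T := fun x => ‖𝓕 (auxC θ) x‖ with hTd
  set Z := fun x => ‖𝓕 (auxC ζ) x‖ with hZd
  set W := fun x => ‖𝓕 (auxC w) x‖ with hWd
  have T0 : ∀ x, 0 ≤ T x := fun x => norm_nonneg _
  have Z0 : ∀ x, 0 ≤ Z x := fun x => norm_nonneg _
  have W0 : ∀ x, 0 ≤ W x := fun x => norm_nonneg _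
  have H0 : ∀ x, 0 ≤ auxH x := fun x => zero_le_one.trans (auxH_one_le x)
  let a : ℝ → ℝ≥0∞ := fun x => ENNReal.ofReal (auxH x * T x)
  let b : ℝ → ℝ≥0∞ := fun x => ENNReal.ofReal (auxH x * Z x)
  let b' : ℝ → ℝ≥0∞ := fun x => ENNReal.ofReal ((auxH x)⁻¹ * Z x)
  let c : ℝ → ℝ≥0∞ := fun x => ENNReal.ofReal (auxH x ^ 2 * W x)
  let c' : ℝ → ℝ≥0∞ := fun x => ENNReal.ofReal (W x)
  have ha : Measurable a := by fun_prop
  have hb : Measurable b := by fun_prop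
  have hb' : Measurable b' := by fun_prop
  have hcc : Measurable c := by fun_prop
  have hc' : Measurable c' := by fun_prop
  have step : ∀ ξ t, ‖𝓕 (auxC θ) ξ‖ₑ * ENNReal.ofReal |ξ| *
      (‖𝓕 (auxC ζ) (ξ - t)‖ₑ * ‖𝓕 (auxC w) t‖ₑ) ≤
      2 * (a ξ * b (ξ - t) * c' t + a ξ * b' (ξ - t) * c t) := by
    intro ξ t
    have hw := aux_weight (ξ - t) t
    rw [sub_add_cancel] at hw
    rw [← ofReal_norm, ← ofReal_norm, ← ofReal_norm]
    change ENNReal.ofReal (T ξ) * _ * (ENNReal.ofReal (Z (ξ - t)) * ENNReal.ofReal (W t)) ≤ _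
    have t0 := T0 ξ
    have z0 := Z0 (ξ - t)
    have w0 := W0 t
    have h0 := H0 ξ
    have h1 := H0 (ξ - t)
    have h2 := H0 t
    simp only [a, b, b', c, c']
    rw [show (2 : ℝ≥0∞) = ENNReal.ofReal 2 by simp]
    repeat rw [← ENNReal.ofReal_mul (by positivity)]
    rw [← ENNReal.ofReal_add (by positivity) (by positivity), ← ENNReal.ofReal_mul (by positivity)]
    apply ENNReal.ofReal_le_ofReal
    calc T ξ * |ξ| * (Z (ξ - t) * W t) = |ξ| * (T ξ * Z (ξ - t) * W t) := by ring
      _ ≤ (2 * (auxH ξ * auxH (ξ - t) + auxH ξ * (auxH (ξ - t))⁻¹ * auxH t ^ 2)) *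
          (T ξ * Z (ξ - t) * W t) := by gcongr
      _ = _ := by ring
  have A : (∫⁻ x, a x ^ 2) ^ ((1 : ℝ) / 2) = ENNReal.ofReal (HhalfNormR θ) := aux_half θ
  have B : (∫⁻ x, b x ^ 2) ^ ((1 : ℝ) / 2) = ENNReal.ofReal (HhalfNormR ζ) := aux_half ζ
  have C : (∫⁻ x, c x ^ 2) ^ ((1 : ℝ) / 2) = ENNReal.ofReal (HoneNormR w) := aux_one w
  have B' : ∫⁻ x, b' x ≤ ENNReal.ofReal (Real.sqrt Real.pi) * ENNReal.ofReal (HhalfNormR ζ) := by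
    rw [← B]
    refine le_trans (le_of_eq ?_) (aux_L1 _ (by fun_prop))
    refine lintegral_congr fun x => ?_
    have := auxH_one_le x
    have : auxH x ≠ 0 := by positivity
    simp only [b']
    congr 1; field_simp
  have C' : ∫⁻ x, c' x ≤ ENNReal.ofReal (Real.sqrt Real.pi) * ENNReal.ofReal (HoneNormR w) := by
    rw [← C]
    refine le_trans (le_of_eq ?_) (aux_L1 _ (by fun_prop))
    refine lintegral_congr fun x => ?_
    have := auxH_one_le x
    have : auxH x ≠ 0 := by positivity
    simp only [c']
    congr 1; field_simp
  have n1 : 0 ≤ HhalfNormR ζ := Real.sqrt_nonneg _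
  have n2 : 0 ≤ HhalfNormR θ := Real.sqrt_nonneg _
  have n3 : 0 ≤ HoneNormR w := Real.sqrt_nonneg _
  calc _ ≤ ∫⁻ ξ, ∫⁻ t, 2 * (a ξ * b (ξ - t) * c' t + a ξ * b' (ξ - t) * c t) :=
        lintegral_mono fun ξ => lintegral_mono fun t => step ξ t
    _ = 2 * ((∫⁻ ξ, ∫⁻ t, a ξ * b (ξ - t) * c' t) + ∫⁻ ξ, ∫⁻ t, a ξ * b' (ξ - t) * c t) := by
        rw [← lintegral_add_left (by fun_prop), ← lintegral_const_mul _ (by fun_prop)]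
        refine lintegral_congr fun ξ => ?_
        rw [← lintegral_add_left (by fun_prop), ← lintegral_const_mul _ (by fun_prop)]
    _ ≤ 2 * (ENNReal.ofReal (HhalfNormR θ) * ENNReal.ofReal (HhalfNormR ζ) *
          (ENNReal.ofReal (Real.sqrt Real.pi) * ENNReal.ofReal (HoneNormR w)) +
          ENNReal.ofReal (HhalfNormR θ) * ENNReal.ofReal (HoneNormR w) *
          (ENNReal.ofReal (Real.sqrt Real.pi) * ENNReal.ofReal (HhalfNormR ζ))) := by
        gcongr
        · refine (aux_young a b c' ha hb hc').trans ?_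
          rw [A, B]; gcongr
        · refine (aux_young' a b' c ha hb' hcc).trans ?_
          rw [A, C]; gcongr
    _ = _ := by
        rw [show (2 : ℝ≥0∞) = ENNReal.ofReal 2 by simp]
        repeat rw [← ENNReal.ofReal_mul (by positivity)]
        rw [← ENNReal.ofReal_add (by positivity) (by positivity),
          ← ENNReal.ofReal_mul (by positivity)]
        congr 1; ring

theorem integral_theta_deriv_zeta_w :
    ∃ C : ℝ, 0 < C ∧ ∀ (θ ζ : 𝓢(ℝ, ℝ)) (w : 𝓢(ℝ, ℝ)),
      |∫ x : ℝ, θ x * deriv (fun y => ζ y * w y) x|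
        ≤ C * HhalfNormR ζ * HhalfNormR θ * HoneNormR w := by
  refine ⟨2 * Real.pi * (4 * Real.sqrt Real.pi), by positivity, fun θ ζ w => ?_⟩
  have n1 : 0 ≤ HhalfNormR ζ := Real.sqrt_nonneg _
  have n2 : 0 ≤ HhalfNormR θ := Real.sqrt_nonneg _
  have n3 : 0 ≤ HoneNormR w := Real.sqrt_nonneg _
  set P := auxP (auxC ζ) (auxC w) with hP
  have hderiv : ∀ x, derivCLM ℂ ℂ P x = ((deriv (fun y => ζ y * w y) x : ℝ) : ℂ) := by
    intro x
    rw [derivCLM_apply]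
    have : ⇑P = fun y => ((ζ y * w y : ℝ) : ℂ) := by
      ext y; rw [hP, auxP_apply]; simp [auxC_apply]
    rw [this]
    have hd : DifferentiableAt ℝ (fun y => ζ y * w y) x :=
      (ζ.differentiableAt).mul w.differentiableAt
    exact hd.hasDerivAt.ofReal_comp.deriv
  have hF : ∀ ξ, ‖𝓕 (derivCLM ℂ ℂ P) ξ‖ₑ
      = ENNReal.ofReal (2 * Real.pi) * ENNReal.ofReal |ξ| * ‖𝓕 P ξ‖ₑ := by
    intro ξ
    have h1 : 𝓕 (derivCLM ℂ ℂ P) ξ = (2 * Real.pi * Complex.I * ξ) • 𝓕 P ξ := by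
      have := Real.fourier_deriv (f := P) P.integrable P.differentiable
        (derivCLM ℂ ℂ P).integrable
      exact congrFun this ξ
    rw [h1, enorm_smul, ← ofReal_norm, ← ENNReal.ofReal_mul (by positivity)]
    congr 2
    simp [abs_of_pos Real.pi_pos]
  have hpl := integral_inner_fourier_fourier (auxC θ) (derivCLM ℂ ℂ P)
  have hI : ∫ x, ⟪auxC θ x, derivCLM ℂ ℂ P x⟫_ℂ
      = ((∫ x : ℝ, θ x * deriv (fun y => ζ y * w y) x : ℝ) : ℂ) := by
    rw [← integral_complex_ofReal]
    refine integral_congr_ae (.of_forall fun x => ?_)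
    simp only [hderiv, auxC_apply]
    simp [mul_comm]
  rw [hI] at hpl
  rw [← Real.norm_eq_abs, ← Complex.norm_real, ← hpl,
    ← ENNReal.ofReal_le_ofReal_iff (by positivity), ofReal_norm]
  calc _ ≤ ∫⁻ ξ, ‖⟪𝓕 (auxC θ) ξ, 𝓕 (derivCLM ℂ ℂ P) ξ⟫_ℂ‖ₑ :=
        enorm_integral_le_lintegral_enorm _
    _ ≤ ∫⁻ ξ, ENNReal.ofReal (2 * Real.pi) * ∫⁻ t, ‖𝓕 (auxC θ) ξ‖ₑ * ENNReal.ofReal |ξ| *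
      (‖𝓕 (auxC ζ) (ξ - t)‖ₑ * ‖𝓕 (auxC w) t‖ₑ) := by
        refine lintegral_mono fun ξ => ?_
        rw [lintegral_const_mul' _ _ (by finiteness)]
        have : ‖⟪𝓕 (auxC θ) ξ, 𝓕 (derivCLM ℂ ℂ P) ξ⟫_ℂ‖ₑ
            ≤ ‖𝓕 (auxC θ) ξ‖ₑ * ‖𝓕 (derivCLM ℂ ℂ P) ξ‖ₑ := by
          simp only [← ofReal_norm]
          rw [← ENNReal.ofReal_mul (by positivity)]
          exact ENNReal.ofReal_le_ofReal (norm_inner_le_norm _ _)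
        refine this.trans ?_
        rw [hF]
        calc _ = ENNReal.ofReal (2 * Real.pi) * (‖𝓕 (auxC θ) ξ‖ₑ * ENNReal.ofReal |ξ| * ‖𝓕 P ξ‖ₑ) := by
              ring
          _ ≤ _ := by
              gcongr
              exact auxP_fourier _ _ _
    _ = ENNReal.ofReal (2 * Real.pi) * ∫⁻ ξ, ∫⁻ t, ‖𝓕 (auxC θ) ξ‖ₑ * ENNReal.ofReal |ξ| *
      (‖𝓕 (auxC ζ) (ξ - t)‖ₑ * ‖𝓕 (auxC w) t‖ₑ) := lintegral_const_mul' _ _ (by finiteness)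
    _ ≤ ENNReal.ofReal (2 * Real.pi) * ENNReal.ofReal
        (4 * Real.sqrt Real.pi * HhalfNormR ζ * HhalfNormR θ * HoneNormR w) := by
        gcongr; exact aux_main θ ζ w
    _ = _ := by
        rw [← ENNReal.ofReal_mul (by positivity)]
        congr 1; ring
end
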